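/- (Laffey–Šmigoc reduction) If A = !![a, b; b, c] is a 2×2 doubly nonnegative integer matrix with b > c, then there exist a', b', c' ∈ ℕ with a'*c' ≥ b'², a' ≥ b' and c' ≥ b', such that the matrix A' = !![a', b'; b', c'] has the same integer CP rank as A; that is, for every k ∈ ℕ, there exists B : Matrix (Fin 2) (Fin k) ℕ with B * Bᵀ = A if and only if there exists B' : Matrix (Fin 2) (Fin k) ℕ with B' * B'ᵀ = A'. -/

import Mathlib

open Matrix

/-- The matrix `!![a, b; b, c]` is a Gram matrix of two vectors in `ℕ ^ k`. -/
def HasFactorization (k a b c : ℕ) : Prop :=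
  ∃ x y : Fin k → ℕ, ∑ i, x i * x i = a ∧ ∑ i, x i * y i = b ∧ ∑ i, y i * y i = c

theorem exists_mul_transpose_iff_hasFactorization (k a b c : ℕ) :
    (∃ B : Matrix (Fin 2) (Fin k) ℕ, B * Bᵀ = !![a, b; b, c]) ↔ HasFactorization k a b c := by
  constructor
  · rintro ⟨B, hB⟩
    have entry (i j : Fin 2) : ∑ l, B i l * B j l = !![a, b; b, c] i j := by
      rw [← hB]
      simp [Matrix.mul_apply]
    exact ⟨B 0, B 1, entry 0 0, entry 0 1, entry 1 1⟩
  · rintro ⟨x, y, rfl, rfl, rfl⟩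
    refine ⟨Matrix.of ![x, y], ?_⟩
    ext i j
    fin_cases i <;> fin_cases j <;> simp [Matrix.mul_apply, mul_comm]

namespace HasFactorization

theorem zero (k : ℕ) : HasFactorization k 0 0 0 := ⟨0, 0, by simp⟩

theorem cons {k a b c : ℕ} (h : HasFactorization k a b c) (u v : ℕ) :
    HasFactorization (k + 1) (a + u * u) (b + u * v) (c + v * v) := by
  obtain ⟨x, y, rfl, rfl, rfl⟩ := h
  exact ⟨Fin.cons u x, Fin.cons v y, by simp [Fin.sum_univ_succ, add_comm]⟩

theorem mono {k l a b c : ℕ} (h : HasFactorization k a b c) (hkl : k ≤ l) :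
    HasFactorization l a b c := by
  induction hkl with
  | refl => exact h
  | step _ ih => exact ih.cons 0 0

theorem symm {k a b c : ℕ} (h : HasFactorization k a b c) : HasFactorization k c b a := by
  obtain ⟨x, y, hx, hxy, hy⟩ := h
  exact ⟨y, x, hy, by simpa only [mul_comm] using hxy, hx⟩

/-- Adding the second row of a factorization to the first one. -/
theorem add_row {k a b c : ℕ} (h : HasFactorization k a b c) :
    HasFactorization k (a + 2 * b + c) (b + c) c := by
  obtain ⟨x, y, rfl, rfl, rfl⟩ := h
  refine ⟨x + y, y, ?_, ?_, rfl⟩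
  · simp only [Pi.add_apply, Finset.mul_sum, ← Finset.sum_add_distrib]
    exact Finset.sum_congr rfl fun i _ => by ring
  · simp only [Pi.add_apply, add_mul, Finset.sum_add_distrib]

end HasFactorization

/-- If one column more never helps for diagonally dominant matrices, then `m` columns suffice
for all of them. -/
theorem hasFactorization_of_forall_succ {m : ℕ}
    (hm : ∀ b s t, HasFactorization (m + 1) (b + s) b (b + t) →
      HasFactorization m (b + s) b (b + t)) (b s t : ℕ) :
    HasFactorization m (b + s) b (b + t) := by
  induction t with
  | zero =>
    induction s with
    | zero =>
      induction b with
      | zero => exact .zero m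
      | succ b ih => exact hm (b + 1) 0 0 (ih.cons 1 1)
    | succ s ih => exact hm b (s + 1) 0 (ih.cons 1 0)
  | succ t ih => exact hm b s (t + 1) (ih.cons 0 1)

theorem exists_hasFactorization (b s t : ℕ) : ∃ k, HasFactorization k (b + s) b (b + t) := by
  induction t with
  | zero =>
    induction s with
    | zero =>
      induction b with
      | zero => exact ⟨0, .zero 0⟩
      | succ b ih => exact ih.imp' _ fun _ h => h.cons 1 1
    | succ s ih => exact ih.imp' _ fun _ h => h.cons 1 0
  | succ t ih => exact ih.imp' _ fun _ h => h.cons 0 1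

/-- A doubly nonnegative `2 × 2` matrix reduces to a diagonally dominant one, all of whose
factorizations lift. -/
theorem exists_diagDominant_reduction (a b c : ℕ) (h : b ^ 2 ≤ a * c) :
    ∃ b' s t, ∀ k, HasFactorization k (b' + s) b' (b' + t) → HasFactorization k a b c := by
  induction b using Nat.strong_induction_on generalizing a c with
  | _ b ih =>
  have step (a c : ℕ) (h : b ^ 2 ≤ a * c) (hbc : c < b) :
      ∃ b' s t, ∀ k, HasFactorization k (b' + s) b' (b' + t) → HasFactorization k a b c := by
    have hc : 0 < c := by
      by_contra! hc
      obtain rfl : c = 0 := by omega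
      have : 0 < b ^ 2 := by positivity
      omega
    obtain ⟨d, rfl⟩ := Nat.exists_eq_add_of_lt hbc
    obtain ⟨a', rfl⟩ : ∃ a', a = a' + 2 * (d + 1) + c := by
      have : 2 * (d + 1) + c ≤ a := by
        by_contra! hlt
        nlinarith
      exact ⟨a - (2 * (d + 1) + c), by omega⟩
    obtain ⟨b', s, t, hred⟩ := ih (d + 1) (by omega) a' c (by nlinarith)
    refine ⟨b', s, t, fun k hk => ?_⟩
    have := (hred k hk).add_row
    rwa [show d + 1 + c = c + d + 1 by ring] at this
  by_cases hc : c < b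
  · exact step a c h hc
  by_cases ha : a < b
  · obtain ⟨b', s, t, hred⟩ := step c a (by rwa [mul_comm]) ha
    exact ⟨b', s, t, fun k hk => (hred k hk).symm⟩
  refine ⟨b, a - b, c - b, fun k hk => ?_⟩
  rwa [Nat.add_sub_cancel' (by omega), Nat.add_sub_cancel' (by omega)] at hk

theorem laffey_smigoc_reduction (a b c : ℕ) (h : b ^ 2 ≤ a * c) (hbc : b > c) :
    ∃ a' b' c' : ℕ, b' ^ 2 ≤ a' * c' ∧ a' ≥ b' ∧ c' ≥ b' ∧
      ∀ k : ℕ, (∃ B : Matrix (Fin 2) (Fin k) ℕ, B * Bᵀ = !![a, b; b, c]) ↔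
        (∃ B' : Matrix (Fin 2) (Fin k) ℕ, B' * B'ᵀ = !![a', b'; b', c']) := by
  classical
  simp only [exists_mul_transpose_iff_hasFactorization]
  obtain ⟨b₀, s₀, t₀, hred⟩ := exists_diagDominant_reduction a b c h
  have hex : ∃ k, HasFactorization k a b c := (exists_hasFactorization b₀ s₀ t₀).imp hred
  obtain ⟨n, hn, hmin⟩ : ∃ n, HasFactorization n a b c ∧ ∀ k < n, ¬ HasFactorization k a b c :=
    ⟨Nat.find hex, Nat.find_spec hex, fun _ => Nat.find_min hex⟩
  cases n with
  | zero =>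
    obtain ⟨x, y, -, hxy, -⟩ := hn
    simp at hxy
    omega
  | succ m =>
    obtain ⟨b', s, t, hsucc, hm⟩ : ∃ b' s t, HasFactorization (m + 1) (b' + s) b' (b' + t) ∧
        ¬ HasFactorization m (b' + s) b' (b' + t) := by
      by_contra! hall
      exact hmin m m.lt_succ_self (hred m (hasFactorization_of_forall_succ hall b₀ s₀ t₀))
    refine ⟨b' + s, b', b' + t, by nlinarith [Nat.zero_le (b' * s), Nat.zero_le (b' * t)],
      by omega, by omega, fun k => ?_⟩
    rcases Nat.lt_or_ge k (m + 1) with hk | hk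
    · exact iff_of_false (hmin k hk) fun hf => hm (hf.mono (by omega))
    · exact iff_of_true (hn.mono hk) (hsucc.mono hk)
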